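/- (Theorem 2.) For α ∈ (0,1) let a(α) be the parameter vector with a(α)_s = α^{γ_s}, let x^{*,a(α)} be the unique minimizer of L^{(a(α))} over X, and let ν^{*,a(α)} ∈ ℝ^I be the unique vector such that x^{*,a(α)}_k = (a(α)_s/c_k)·exp(Σ_i k_i ν_i^{*,a(α)}) for all k ∈ K^s, s ∈ 𝓢. Then, as α → 0+, the distance from x^{*,a(α)} to the set X* tends to 0, and the distance from (−log α)^{−1} ν^{*,a(α)} to the set H* tends to 0. -/

import Mathlib

open scoped BigOperators
open Filter Topology

noncomputable section

variable {I S : Type} [Fintype I] [DecidableEq I] [Fintype S]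

/-- The configuration `e_i` consisting of a single type-`i` customer. -/
def econf (i : I) : I → ℕ := Pi.single i 1

/-- `K^s`: the set of nonzero configurations of server type `s`. -/
def Kc (Kbar : S → Finset (I → ℕ)) (s : S) : Finset (I → ℕ) := (Kbar s).erase 0

/-- Monotonicity of the configuration sets. -/
def KbarMono (Kbar : S → Finset (I → ℕ)) : Prop :=
  ∀ s, ∀ k ∈ Kbar s, ∀ k' : I → ℕ, (∀ i, k' i ≤ k i) → k' ∈ Kbar s

/-- Each configuration set contains the zero configuration. -/
def KbarZero (Kbar : S → Finset (I → ℕ)) : Prop := ∀ s, (0 : I → ℕ) ∈ Kbar s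

/-- Every customer type can be served by some server type. -/
def KbarServe (Kbar : S → Finset (I → ℕ)) : Prop := ∀ i : I, ∃ s, econf i ∈ Kbar s

/-- `ℝ_+^K`: nonnegative vectors supported on the nonzero configurations. -/
def orthK (Kbar : S → Finset (I → ℕ)) : Set (S → (I → ℕ) → ℝ) :=
  {x | (∀ s k, 0 ≤ x s k) ∧ ∀ s, ∀ k, k ∉ Kc Kbar s → x s k = 0}

/-- The feasible set `X` (equality constraints). -/
def feasX (Kbar : S → Finset (I → ℕ)) (ρ : I → ℝ) : Set (S → (I → ℕ) → ℝ) :=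
  {x | x ∈ orthK Kbar ∧ ∀ i, ∑ s, ∑ k ∈ Kc Kbar s, (k i : ℝ) * x s k = ρ i}

/-- The relaxed feasible set (inequality constraints). -/
def feasXge (Kbar : S → Finset (I → ℕ)) (ρ : I → ℝ) : Set (S → (I → ℕ) → ℝ) :=
  {x | x ∈ orthK Kbar ∧ ∀ i, ρ i ≤ ∑ s, ∑ k ∈ Kc Kbar s, (k i : ℝ) * x s k}

/-- The weighted number of occupied servers. -/
def objW (Kbar : S → Finset (I → ℕ)) (γ : S → ℝ) (x : S → (I → ℕ) → ℝ) : ℝ :=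
  ∑ s, ∑ k ∈ Kc Kbar s, γ s * x s k

/-- `X*`: optimal solutions of LP=. -/
def XstarSet (Kbar : S → Finset (I → ℕ)) (ρ : I → ℝ) (γ : S → ℝ) :
    Set (S → (I → ℕ) → ℝ) :=
  {x | x ∈ feasX Kbar ρ ∧ ∀ y ∈ feasX Kbar ρ, objW Kbar γ x ≤ objW Kbar γ y}

/-- `X**`: optimal solutions of LP≤. -/
def XstarSetGe (Kbar : S → Finset (I → ℕ)) (ρ : I → ℝ) (γ : S → ℝ) :
    Set (S → (I → ℕ) → ℝ) :=
  {x | x ∈ feasXge Kbar ρ ∧ ∀ y ∈ feasXge Kbar ρ, objW Kbar γ x ≤ objW Kbar γ y}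

/-- `H*`: dual optimal vectors. -/
def HstarSet (Kbar : S → Finset (I → ℕ)) (ρ : I → ℝ) (γ : S → ℝ) : Set (I → ℝ) :=
  {η | ∃ x ∈ feasX Kbar ρ, (∀ i, 0 ≤ η i) ∧
    (∀ s, ∀ k ∈ Kc Kbar s, ∑ i, (k i : ℝ) * η i ≤ γ s) ∧
    (∀ s, ∀ k ∈ Kc Kbar s, (∑ i, (k i : ℝ) * η i) < γ s → x s k = 0)}

/-- `c_k = ∏_i k_i!`. -/
def ck (k : I → ℕ) : ℝ := ∏ i, (Nat.factorial (k i) : ℝ)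

/-- The function `L^{(a)}`. -/
def Lfun (Kbar : S → Finset (I → ℕ)) (a : S → ℝ) (x : S → (I → ℕ) → ℝ) : ℝ :=
  ∑ s, ∑ k ∈ Kc Kbar s, x s k * Real.log (x s k * ck k / (Real.exp 1 * a s))

/-- Product form (infinite-server system). -/
def prodForm (Kbar : S → Finset (I → ℕ)) (a : S → ℝ) (x : S → (I → ℕ) → ℝ)
    (ν : I → ℝ) : Prop :=
  ∀ s, ∀ k ∈ Kc Kbar s, x s k = a s / ck k * Real.exp (∑ i, (k i : ℝ) * ν i)

/-- ℓ¹ distance on the coordinates indexed by `K`. -/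
def distK (Kbar : S → Finset (I → ℕ)) (x y : S → (I → ℕ) → ℝ) : ℝ :=
  ∑ s, ∑ k ∈ Kc Kbar s, |x s k - y s k|

/-- Extended coordinate value: the zero configuration of type `s` has value `a_s`. -/
def xval (a : S → ℝ) (x : S → (I → ℕ) → ℝ) (s : S) (k : I → ℕ) : ℝ :=
  if k = 0 then a s else x s k

/-- `x_{(i)}`: amount of servers available to a type-`i` arrival (GRAND(aZ)). -/
def xavail (Kbar : S → Finset (I → ℕ)) (a : S → ℝ) (x : S → (I → ℕ) → ℝ) (i : I) : ℝ :=
  ∑ s, ((if econf i ∈ Kc Kbar s then a s else 0)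
    + ∑ k ∈ (Kc Kbar s).filter (fun k => k + econf i ∈ Kbar s), x s k)

/-- Departure rate `w_{k i}`. -/
def wrate (μ : I → ℝ) (x : S → (I → ℕ) → ℝ) (s : S) (k : I → ℕ) (i : I) : ℝ :=
  (k i : ℝ) * μ i * x s k

/-- Arrival rate `v_{k i}` (GRAND(aZ)), with `λ_i = μ_i ρ_i`. -/
def vrate (Kbar : S → Finset (I → ℕ)) (a : S → ℝ) (μ ρ : I → ℝ)
    (x : S → (I → ℕ) → ℝ) (s : S) (k : I → ℕ) (i : I) : ℝ :=
  μ i * ρ i * xval a x s (k - econf i) / xavail Kbar a x i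

/-- The GRAND(aZ) fluid vector field `F_k(x)`, for `k ∈ K^s`. -/
def Fdrift (Kbar : S → Finset (I → ℕ)) (a : S → ℝ) (μ ρ : I → ℝ)
    (x : S → (I → ℕ) → ℝ) (s : S) (k : I → ℕ) : ℝ :=
  (∑ i ∈ Finset.univ.filter (fun i : I => 1 ≤ k i ∧ k - econf i ∈ Kbar s),
    (vrate Kbar a μ ρ x s k i - wrate μ x s k i))
  - ∑ i ∈ Finset.univ.filter (fun i : I => k + econf i ∈ Kbar s),
    (vrate Kbar a μ ρ x s (k + econf i) i - wrate μ x s (k + econf i) i)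

/-- The function `Ξ(x)` (GRAND(aZ)). -/
def Xi (Kbar : S → Finset (I → ℕ)) (a : S → ℝ) (μ : I → ℝ)
    (x : S → (I → ℕ) → ℝ) : ℝ :=
  ∑ i : I, ∑ s : S,
    ∑ k ∈ (Kc Kbar s).filter (fun k => 1 ≤ k i ∧ k - econf i ∈ Kbar s),
      ∑ s' : S,
        ∑ k' ∈ (Kc Kbar s').filter (fun k' => 1 ≤ k' i ∧ k' - econf i ∈ Kbar s'),
          (Real.log ((k' i : ℝ) * xval a x s (k - econf i) * x s' k')
            - Real.log ((k i : ℝ) * x s k * xval a x s' (k' - econf i)))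
          * ((k i : ℝ) * μ i * x s k * xval a x s' (k' - econf i) / xavail Kbar a x i)

open Classical in
/-- `Ξ` extended by `−∞` to points with a vanishing coordinate, as a map into `[−∞, 0] ⊆ EReal`. -/
def XiE (Kbar : S → Finset (I → ℕ)) (a : S → ℝ) (μ : I → ℝ)
    (x : S → (I → ℕ) → ℝ) : EReal :=
  if ∀ s, ∀ k ∈ Kc Kbar s, 0 < x s k then ((Xi Kbar a μ x : ℝ) : EReal) else ⊥

/-! Finite-server (GRAND-F) objects. -/

/-- `X^□`. -/
def XBox (Kbar : S → Finset (I → ℕ)) (h : S → ℝ) : Set (S → (I → ℕ) → ℝ) :=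
  {x | x ∈ orthK Kbar ∧ ∀ s, ∑ k ∈ Kc Kbar s, x s k ≤ h s}

/-- `x_{0^s} = h_s − Σ_{k∈K^s} x_k`. -/
def x0 (Kbar : S → Finset (I → ℕ)) (h : S → ℝ) (x : S → (I → ℕ) → ℝ) (s : S) : ℝ :=
  h s - ∑ k ∈ Kc Kbar s, x s k

/-- `X^⋄ = X^□ ∩ X`. -/
def XDiamond (Kbar : S → Finset (I → ℕ)) (h : S → ℝ) (ρ : I → ℝ) :
    Set (S → (I → ℕ) → ℝ) := XBox Kbar h ∩ feasX Kbar ρ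

/-- Assumption A: a feasible point with idle servers of every type. -/
def AssumptionA (Kbar : S → Finset (I → ℕ)) (h : S → ℝ) (ρ : I → ℝ) : Prop :=
  ∃ x ∈ XDiamond Kbar h ρ, ∀ s, 0 < x0 Kbar h x s

/-- The function `L^□`. -/
def LBox (Kbar : S → Finset (I → ℕ)) (h : S → ℝ) (x : S → (I → ℕ) → ℝ) : ℝ :=
  ∑ s, (x0 Kbar h x s * Real.log (x0 Kbar h x s / Real.exp 1)
    + ∑ k ∈ Kc Kbar s, x s k * Real.log (x s k * ck k / Real.exp 1))

/-- Product form (finite-server system), including the zero configurations. -/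
def prodFormBox (Kbar : S → Finset (I → ℕ)) (h : S → ℝ) (x : S → (I → ℕ) → ℝ)
    (ν : I → ℝ) (β : S → ℝ) : Prop :=
  ∀ s, x0 Kbar h x s = Real.exp (-β s) ∧
    ∀ k ∈ Kc Kbar s, x s k = Real.exp (-β s) / ck k * Real.exp (∑ i, (k i : ℝ) * ν i)

/-- Extended coordinate value for the finite-server system. -/
def xvalBox (Kbar : S → Finset (I → ℕ)) (h : S → ℝ) (x : S → (I → ℕ) → ℝ)
    (s : S) (k : I → ℕ) : ℝ :=
  if k = 0 then x0 Kbar h x s else x s k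

/-- `x_{(i)}` for the finite-server system (zero configurations included). -/
def xavailBox (Kbar : S → Finset (I → ℕ)) (h : S → ℝ) (x : S → (I → ℕ) → ℝ)
    (i : I) : ℝ :=
  ∑ s, ((if econf i ∈ Kc Kbar s then x0 Kbar h x s else 0)
    + ∑ k ∈ (Kc Kbar s).filter (fun k => k + econf i ∈ Kbar s), x s k)

/-- Arrival rate `v_{k i}` (GRAND-F), with `λ_i = μ_i ρ_i`. -/
def vrateBox (Kbar : S → Finset (I → ℕ)) (h : S → ℝ) (μ ρ : I → ℝ)
    (x : S → (I → ℕ) → ℝ) (s : S) (k : I → ℕ) (i : I) : ℝ :=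
  μ i * ρ i * xvalBox Kbar h x s (k - econf i) / xavailBox Kbar h x i

/-- The GRAND-F fluid vector field `F^□_k(x)`, for `k ∈ K^s`. -/
def FdriftBox (Kbar : S → Finset (I → ℕ)) (h : S → ℝ) (μ ρ : I → ℝ)
    (x : S → (I → ℕ) → ℝ) (s : S) (k : I → ℕ) : ℝ :=
  (∑ i ∈ Finset.univ.filter (fun i : I => 1 ≤ k i ∧ k - econf i ∈ Kbar s),
    (vrateBox Kbar h μ ρ x s k i - wrate μ x s k i))
  - ∑ i ∈ Finset.univ.filter (fun i : I => k + econf i ∈ Kbar s),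
    (vrateBox Kbar h μ ρ x s (k + econf i) i - wrate μ x s (k + econf i) i)

/-- The function `Ξ^□(x̄)`. -/
def XiBox (Kbar : S → Finset (I → ℕ)) (h : S → ℝ) (μ : I → ℝ)
    (x : S → (I → ℕ) → ℝ) : ℝ :=
  ∑ i : I, ∑ s : S,
    ∑ k ∈ (Kc Kbar s).filter (fun k => 1 ≤ k i ∧ k - econf i ∈ Kbar s),
      ∑ s' : S,
        ∑ k' ∈ (Kc Kbar s').filter (fun k' => 1 ≤ k' i ∧ k' - econf i ∈ Kbar s'),
          (Real.log ((k' i : ℝ) * xvalBox Kbar h x s (k - econf i) * x s' k')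
            - Real.log ((k i : ℝ) * x s k * xvalBox Kbar h x s' (k' - econf i)))
          * ((k i : ℝ) * μ i * x s k * xvalBox Kbar h x s' (k' - econf i)
              / xavailBox Kbar h x i)

set_option linter.unusedSectionVars false

theorem ck_pos (k : I → ℕ) : 0 < ck k :=
  Finset.prod_pos fun i _ => by exact_mod_cast Nat.factorial_pos (k i)

theorem feasX_le_sum {Kbar : S → Finset (I → ℕ)} {ρ : I → ℝ} (hρ : ∀ i, 0 ≤ ρ i)
    {x : S → (I → ℕ) → ℝ} (hx : x ∈ feasX Kbar ρ) (s : S) (k : I → ℕ) :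
    x s k ≤ ∑ i, ρ i := by
  by_cases hk : k ∈ Kc Kbar s
  · obtain ⟨i, hi⟩ : ∃ i, k i ≠ 0 := Function.ne_iff.1 (Finset.mem_erase.1 hk).1
    have hnn : ∀ s k, 0 ≤ (k i : ℝ) * x s k := fun s k =>
      mul_nonneg (Nat.cast_nonneg _) (hx.1.1 s k)
    have hki : (1 : ℝ) ≤ k i := by exact_mod_cast Nat.one_le_iff_ne_zero.2 hi
    calc x s k ≤ (k i : ℝ) * x s k := le_mul_of_one_le_left (hx.1.1 s k) hki
      _ ≤ ∑ k ∈ Kc Kbar s, (k i : ℝ) * x s k :=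
        Finset.single_le_sum (f := fun k => (k i : ℝ) * x s k) (fun k _ => hnn s k) hk
      _ ≤ ∑ s, ∑ k ∈ Kc Kbar s, (k i : ℝ) * x s k :=
        Finset.single_le_sum (f := fun s => ∑ k ∈ Kc Kbar s, (k i : ℝ) * x s k)
          (fun s _ => Finset.sum_nonneg fun k _ => hnn s k) (Finset.mem_univ s)
      _ = ρ i := hx.2 i
      _ ≤ ∑ i, ρ i := Finset.single_le_sum (fun i _ => hρ i) (Finset.mem_univ i)
  · rw [hx.1.2 s k hk]
    exact Finset.sum_nonneg fun i _ => hρ i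

theorem exists_pos_of_mem_feasX {Kbar : S → Finset (I → ℕ)} {ρ : I → ℝ}
    {x : S → (I → ℕ) → ℝ} (hx : x ∈ feasX Kbar ρ) {i : I} (hi : 0 < ρ i) :
    ∃ s, ∃ k ∈ Kc Kbar s, k i ≠ 0 ∧ 0 < x s k := by
  by_contra! h
  refine hi.ne' ((hx.2 i).symm.trans ?_)
  refine Finset.sum_eq_zero fun s _ => Finset.sum_eq_zero fun k hk => ?_
  by_cases hki : k i = 0
  · simp [hki]
  · simp [le_antisymm (h s k hk hki) (hx.1.1 s k)]

theorem feasX_of_tendsto {Kbar : S → Finset (I → ℕ)} {ρ : I → ℝ} {α : Type*} {l : Filter α}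
    [l.NeBot] {f : α → S → (I → ℕ) → ℝ} {x : S → (I → ℕ) → ℝ}
    (hf : ∀ᶠ a in l, f a ∈ feasX Kbar ρ)
    (h : ∀ s k, Tendsto (fun a => f a s k) l (𝓝 (x s k))) : x ∈ feasX Kbar ρ := by
  refine ⟨⟨fun s k => ge_of_tendsto (h s k) (hf.mono fun a ha => ha.1.1 s k),
    fun s k hk => ?_⟩, fun i => ?_⟩
  · exact tendsto_nhds_unique (h s k)
      (tendsto_const_nhds.congr' (hf.mono fun a ha => (ha.1.2 s k hk).symm))
  · have hlim : Tendsto (fun a => ∑ s, ∑ k ∈ Kc Kbar s, (k i : ℝ) * f a s k) l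
        (𝓝 (∑ s, ∑ k ∈ Kc Kbar s, (k i : ℝ) * x s k)) :=
      tendsto_finsetSum _ fun s _ => tendsto_finsetSum _ fun k _ => (h s k).const_mul _
    exact tendsto_nhds_unique hlim
      (tendsto_const_nhds.congr' (hf.mono fun a ha => (ha.2 i).symm))

theorem sum_weight_mul_of_mem_feasX {Kbar : S → Finset (I → ℕ)} {ρ : I → ℝ}
    {x : S → (I → ℕ) → ℝ} (hx : x ∈ feasX Kbar ρ) (η : I → ℝ) :
    ∑ s, ∑ k ∈ Kc Kbar s, (∑ i, (k i : ℝ) * η i) * x s k = ∑ i, ρ i * η i := by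
  simp_rw [← hx.2, Finset.sum_mul]
  rw [Finset.sum_comm]
  refine Finset.sum_congr rfl fun s _ => ?_
  rw [Finset.sum_comm]
  exact Finset.sum_congr rfl fun k _ => Finset.sum_congr rfl fun i _ => by ring

/-- Weak duality: complementary slackness certifies primal optimality. -/
theorem mem_XstarSet_of_slackness {Kbar : S → Finset (I → ℕ)} {ρ : I → ℝ} {γ : S → ℝ}
    {x : S → (I → ℕ) → ℝ} (hx : x ∈ feasX Kbar ρ) {η : I → ℝ}
    (hle : ∀ s, ∀ k ∈ Kc Kbar s, ∑ i, (k i : ℝ) * η i ≤ γ s)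
    (hslack : ∀ s, ∀ k ∈ Kc Kbar s, (∑ i, (k i : ℝ) * η i) < γ s → x s k = 0) :
    x ∈ XstarSet Kbar ρ γ := by
  refine ⟨hx, fun y hy => ?_⟩
  calc objW Kbar γ x = ∑ s, ∑ k ∈ Kc Kbar s, (∑ i, (k i : ℝ) * η i) * x s k := by
        refine Finset.sum_congr rfl fun s _ => Finset.sum_congr rfl fun k hk => ?_
        rcases (hle s k hk).lt_or_eq with h | h
        · simp [hslack s k hk h]
        · rw [h]
    _ = ∑ s, ∑ k ∈ Kc Kbar s, (∑ i, (k i : ℝ) * η i) * y s k := by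
        rw [sum_weight_mul_of_mem_feasX hx, sum_weight_mul_of_mem_feasX hy]
    _ ≤ objW Kbar γ y := Finset.sum_le_sum fun s _ => Finset.sum_le_sum fun k hk =>
        mul_le_mul_of_nonneg_right (hle s k hk) (hy.1.1 s k)

theorem sum_weight_scaled_eq {Kbar : S → Finset (I → ℕ)} {γ : S → ℝ} {α : ℝ}
    (hα : α ∈ Set.Ioo (0 : ℝ) 1) {x : S → (I → ℕ) → ℝ} {ν : I → ℝ}
    (h : prodForm Kbar (fun s => α ^ γ s) x ν) {s : S} {k : I → ℕ} (hk : k ∈ Kc Kbar s) :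
    ∑ i, (k i : ℝ) * (ν i / (-Real.log α))
      = γ s + (Real.log (x s k) + Real.log (ck k)) * (-Real.log α)⁻¹ := by
  have hb : Real.log α ≠ 0 := (Real.log_neg hα.1 hα.2).ne
  have hrp : (0 : ℝ) < α ^ γ s := Real.rpow_pos_of_pos hα.1 _
  have hlog : Real.log (x s k)
      = γ s * Real.log α - Real.log (ck k) + ∑ i, (k i : ℝ) * ν i := by
    rw [h s k hk, Real.log_mul (div_pos hrp (ck_pos k)).ne' (Real.exp_pos _).ne',
      Real.log_exp, Real.log_div hrp.ne' (ck_pos k).ne', Real.log_rpow hα.1]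
  have hsum : ∑ i, (k i : ℝ) * (ν i / (-Real.log α))
      = (∑ i, (k i : ℝ) * ν i) * (-Real.log α)⁻¹ := by
    rw [Finset.sum_mul]
    exact Finset.sum_congr rfl fun i _ => by rw [div_eq_mul_inv, mul_assoc]
  rw [hsum, hlog]
  field_simp
  ring

theorem sum_weight_scaled_le {Kbar : S → Finset (I → ℕ)} {γ : S → ℝ} {α : ℝ}
    (hα : α ∈ Set.Ioo (0 : ℝ) 1) {x : S → (I → ℕ) → ℝ} {ν : I → ℝ}
    (h : prodForm Kbar (fun s => α ^ γ s) x ν) {s : S} (hγ : 0 ≤ γ s) {k : I → ℕ}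
    (hk : k ∈ Kbar s) (hx0 : 0 ≤ x s k) (hx1 : x s k ≤ 1) :
    ∑ i, (k i : ℝ) * (ν i / (-Real.log α))
      ≤ γ s + Real.log (ck k) * (-Real.log α)⁻¹ := by
  by_cases hk0 : k = 0
  · simp [hk0, ck, hγ]
  · have hb : 0 < -Real.log α := neg_pos.2 (Real.log_neg hα.1 hα.2)
    rw [sum_weight_scaled_eq hα h (Finset.mem_erase.2 ⟨hk0, hk⟩)]
    gcongr
    linarith [Real.log_nonpos hx0 hx1]

theorem exists_tendsto_of_eventually_mem_Icc {α : Type*} (U : Ultrafilter α) {f : α → ℝ}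
    {a b : ℝ} (h : ∀ᶠ t in (U : Filter α), f t ∈ Set.Icc a b) :
    ∃ y, Tendsto f U (𝓝 y) := by
  obtain ⟨y, -, hy⟩ := isCompact_Icc.ultrafilter_le_nhds' (U.map f) h
  exact ⟨y, hy⟩

/-- Along any ultrafilter converging to `0+`, the feasible product-form points and their scaled
multipliers converge to a primal optimal and a dual optimal point. -/
theorem exists_tendsto_optimal_of_ultrafilter
    {Kbar : S → Finset (I → ℕ)} (hmono : KbarMono Kbar) (hserve : KbarServe Kbar)
    {ρ : I → ℝ} (hρpos : ∀ i, 0 < ρ i) (hρsum : ∑ i, ρ i = 1)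
    {γ : S → ℝ} (hγpos : ∀ s, 0 < γ s)
    {xsel : ℝ → S → (I → ℕ) → ℝ} {νsel : ℝ → I → ℝ}
    (hxsel : ∀ α ∈ Set.Ioo (0 : ℝ) 1, xsel α ∈ feasX Kbar ρ)
    (hνsel : ∀ α ∈ Set.Ioo (0 : ℝ) 1,
      prodForm Kbar (fun s => α ^ γ s) (xsel α) (νsel α))
    (U : Ultrafilter ℝ) (hU : (U : Filter ℝ) ≤ 𝓝[Set.Ioo (0 : ℝ) 1] 0) :
    ∃ x ∈ XstarSet Kbar ρ γ, ∃ η ∈ HstarSet Kbar ρ γ,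
      (∀ s k, Tendsto (fun α => xsel α s k) U (𝓝 (x s k))) ∧
      Tendsto (fun α i => νsel α i / (-Real.log α)) U (𝓝 η) := by
  have hmem : ∀ᶠ α in (U : Filter ℝ), α ∈ Set.Ioo (0 : ℝ) 1 := hU self_mem_nhdsWithin
  have hbinv : Tendsto (fun α => (-Real.log α)⁻¹) U (𝓝 0) := by
    refine tendsto_inv_atTop_zero.comp (tendsto_neg_atBot_atTop.comp ?_)
    exact Real.tendsto_log_nhdsGT_zero.mono_left
      (hU.trans (nhdsWithin_mono _ Set.Ioo_subset_Ioi_self))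
  have hle1 : ∀ α ∈ Set.Ioo (0 : ℝ) 1, ∀ s k, xsel α s k ≤ 1 := fun α hα s k =>
    hρsum ▸ feasX_le_sum (fun i => (hρpos i).le) (hxsel α hα) s k
  have hxlim : ∀ s k, ∃ y, Tendsto (fun α => xsel α s k) U (𝓝 y) := fun s k =>
    exists_tendsto_of_eventually_mem_Icc U
      (hmem.mono fun α hα => ⟨(hxsel α hα).1.1 s k, hle1 α hα s k⟩)
  choose x hx using hxlim
  have hxX : x ∈ feasX Kbar ρ := feasX_of_tendsto (hmem.mono hxsel) hx
  have hub : ∀ s, ∀ k ∈ Kbar s, ∀ᶠ α in (U : Filter ℝ),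
      ∑ i, (k i : ℝ) * (νsel α i / (-Real.log α))
        ≤ γ s + Real.log (ck k) * (-Real.log α)⁻¹ := fun s k hk =>
    hmem.mono fun α hα => sum_weight_scaled_le hα (hνsel α hα) (hγpos s).le hk
      ((hxsel α hα).1.1 s k) (hle1 α hα s k)
  have hub_lim : ∀ s (k : I → ℕ),
      Tendsto (fun α => γ s + Real.log (ck k) * (-Real.log α)⁻¹) U (𝓝 (γ s)) := fun s k => by
    simpa using (hbinv.const_mul (Real.log (ck k))).const_add (γ s)
  have htight : ∀ s, ∀ k ∈ Kc Kbar s, 0 < x s k →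
      Tendsto (fun α => ∑ i, (k i : ℝ) * (νsel α i / (-Real.log α))) U (𝓝 (γ s)) := by
    intro s k hk hpos
    have hlim : Tendsto (fun α => γ s + (Real.log (xsel α s k) + Real.log (ck k))
        * (-Real.log α)⁻¹) U (𝓝 (γ s)) := by
      simpa using ((((hx s k).log hpos.ne').add_const (Real.log (ck k))).mul hbinv).const_add
        (γ s)
    exact hlim.congr' (hmem.mono fun α hα => (sum_weight_scaled_eq hα (hνsel α hα) hk).symm)
  have hlb : ∀ i, ∃ g : ℝ → ℝ, Tendsto g U (𝓝 0) ∧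
      ∀ᶠ α in (U : Filter ℝ), g α ≤ νsel α i / (-Real.log α) := by
    intro i
    obtain ⟨s, k, hk, hki, hpos⟩ := exists_pos_of_mem_feasX hxX (hρpos i)
    have hk' : k - econf i ∈ Kbar s :=
      hmono s k (Finset.mem_erase.1 hk).2 _ fun j => Nat.sub_le _ _
    have hsplit : ∀ η : I → ℝ, ∑ j, (k j : ℝ) * η j
        = ∑ j, ((k - econf i) j : ℝ) * η j + η i := by
      intro η
      have hcast : ∀ j, (k j : ℝ) = ((k - econf i) j : ℝ) + (econf i j : ℝ) := fun j => by
        have : econf i j ≤ k j := by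
          rcases eq_or_ne j i with rfl | hj
          · simpa [econf] using Nat.one_le_iff_ne_zero.2 hki
          · simp [econf, hj]
        rw [← Nat.cast_add, Pi.sub_apply, Nat.sub_add_cancel this]
      simp_rw [hcast, add_mul, Finset.sum_add_distrib]
      congr 1
      simp [econf, Pi.single_apply]
    have hlim := (htight s k hk hpos).sub (hub_lim s (k - econf i))
    rw [sub_self] at hlim
    refine ⟨_, hlim, ?_⟩
    filter_upwards [hub s _ hk'] with α hα
    rw [hsplit]
    linarith
  have hηlim : ∀ i, ∃ y, Tendsto (fun α => νsel α i / (-Real.log α)) U (𝓝 y) := by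
    intro i
    obtain ⟨s, hs⟩ := hserve i
    obtain ⟨g, hg, hgle⟩ := hlb i
    refine exists_tendsto_of_eventually_mem_Icc U (a := -1) (b := γ s + 1) ?_
    filter_upwards [hgle, hg.eventually_const_lt neg_one_lt_zero, hub s _ hs,
      (hub_lim s (econf i)).eventually_lt_const (lt_add_one _)] with α h1 h2 h3 h4
    have hsingle : ∑ j, (econf i j : ℝ) * (νsel α j / (-Real.log α))
        = νsel α i / (-Real.log α) := by
      simp [econf, Pi.single_apply]
    rw [hsingle] at h3
    exact ⟨by linarith, by linarith⟩
  choose η hη using hηlim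
  have hηsum : ∀ k : I → ℕ, Tendsto (fun α => ∑ i, (k i : ℝ) * (νsel α i / (-Real.log α))) U
      (𝓝 (∑ i, (k i : ℝ) * η i)) := fun k =>
    tendsto_finsetSum _ fun i _ => (hη i).const_mul _
  have hle : ∀ s, ∀ k ∈ Kc Kbar s, ∑ i, (k i : ℝ) * η i ≤ γ s := fun s k hk =>
    le_of_tendsto_of_tendsto (hηsum k) (hub_lim s k) (hub s k (Finset.mem_erase.1 hk).2)
  have hslack : ∀ s, ∀ k ∈ Kc Kbar s, (∑ i, (k i : ℝ) * η i) < γ s → x s k = 0 := by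
    intro s k hk hlt
    by_contra hne
    exact hlt.ne (tendsto_nhds_unique (hηsum k)
      (htight s k hk ((hxX.1.1 s k).lt_of_ne' hne)))
  refine ⟨x, mem_XstarSet_of_slackness hxX hle hslack, η,
    ⟨x, hxX, fun i => ?_, hle, hslack⟩, hx, tendsto_pi_nhds.2 hη⟩
  obtain ⟨g, hg, hgle⟩ := hlb i
  exact le_of_tendsto_of_tendsto hg (hη i) hgle

theorem distK_nonneg (Kbar : S → Finset (I → ℕ)) (x y : S → (I → ℕ) → ℝ) :
    0 ≤ distK Kbar x y :=
  Finset.sum_nonneg fun _ _ => Finset.sum_nonneg fun _ _ => abs_nonneg _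

theorem tendsto_distK_zero (Kbar : S → Finset (I → ℕ)) {α : Type*} {l : Filter α}
    {f : α → S → (I → ℕ) → ℝ} {x : S → (I → ℕ) → ℝ}
    (h : ∀ s k, Tendsto (fun a => f a s k) l (𝓝 (x s k))) :
    Tendsto (fun a => distK Kbar (f a) x) l (𝓝 0) := by
  have hlim : Tendsto (fun a => ∑ s, ∑ k ∈ Kc Kbar s, |f a s k - x s k|) l
      (𝓝 (∑ s, ∑ k ∈ Kc Kbar s, |x s k - x s k|)) :=
    tendsto_finsetSum _ fun s _ => tendsto_finsetSum _ fun k _ => ((h s k).sub_const _).abs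
  simpa [distK] using hlim

/-- Theorem 2: as `α → 0+` with `a(α)_s = α^{γ_s}`,
`x^{*,a(α)} → X*` and `(−log α)⁻¹ ν^{*,a(α)} → H*`. -/
theorem grand_minimizers_converge_to_optimal_sets
    (Kbar : S → Finset (I → ℕ))
    (hmono : KbarMono Kbar) (hzero : KbarZero Kbar) (hserve : KbarServe Kbar)
    (ρ : I → ℝ) (hρpos : ∀ i, 0 < ρ i) (hρsum : ∑ i, ρ i = 1)
    (γ : S → ℝ) (hγpos : ∀ s, 0 < γ s) (s₁ : S) (hγ1 : γ s₁ = 1)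
    (xsel : ℝ → S → (I → ℕ) → ℝ) (νsel : ℝ → I → ℝ)
    (hxsel : ∀ α ∈ Set.Ioo (0 : ℝ) 1, xsel α ∈ feasX Kbar ρ ∧
      ∀ y ∈ feasX Kbar ρ,
        Lfun Kbar (fun s => α ^ γ s) (xsel α) ≤ Lfun Kbar (fun s => α ^ γ s) y)
    (hνsel : ∀ α ∈ Set.Ioo (0 : ℝ) 1,
      prodForm Kbar (fun s => α ^ γ s) (xsel α) (νsel α)) :
    Tendsto (fun α => sInf ((fun y => distK Kbar (xsel α) y) '' XstarSet Kbar ρ γ))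
      (nhdsWithin 0 (Set.Ioo (0 : ℝ) 1)) (nhds 0) ∧
    Tendsto (fun α => Metric.infDist (fun i => νsel α i / (-Real.log α))
        (HstarSet Kbar ρ γ))
      (nhdsWithin 0 (Set.Ioo (0 : ℝ) 1)) (nhds 0) := by
  have key := exists_tendsto_optimal_of_ultrafilter hmono hserve hρpos hρsum hγpos
    (fun α hα => (hxsel α hα).1) hνsel
  constructor
  · refine (tendsto_iff_ultrafilter _ _ _).2 fun U hU => ?_
    obtain ⟨x, hx, -, -, hlim, -⟩ := key U hU
    have hnn : ∀ α, ∀ d ∈ (fun y => distK Kbar (xsel α) y) '' XstarSet Kbar ρ γ, 0 ≤ d := by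
      rintro α _ ⟨y, -, rfl⟩
      exact distK_nonneg _ _ _
    exact squeeze_zero (fun α => Real.sInf_nonneg (hnn α))
      (fun α => csInf_le ⟨0, hnn α⟩ ⟨x, hx, rfl⟩) (tendsto_distK_zero Kbar hlim)
  · refine (tendsto_iff_ultrafilter _ _ _).2 fun U hU => ?_
    obtain ⟨-, -, η, hη, -, hlim⟩ := key U hU
    rw [← Metric.infDist_zero_of_mem hη]
    exact ((Metric.continuous_infDist_pt _).tendsto η).comp hlim
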